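/- Let 1 < α < 2, let β satisfy α-1 ≤ β ≤ 1, set λ_n := [sin(πα)/(sin(π(α-β)) + sin(πβ))]·Γ(n+α)/n!, let f : (0,1) → ℝ satisfy ∫₀¹ ρ^{(β-1,α-β-1)} f² < ∞, and define f_i := ∫₀¹ ρ^{(β-1,α-β-1)}(x) f(x) G_i^{(β-1,α-β-1)}(x) dx and c_i := f_{i+1}/(λ_i·|‖G_{i+1}^{(β-1,α-β-1)}‖|²) for i ≥ 0. Then for every N ≥ 0 the series Σ_{i=N}^{∞} c_i² |‖G_i^{(α-β,β)}‖|² converges and satisfies Σ_{i=N}^{∞} c_i² |‖G_i^{(α-β,β)}‖|² ≤ (1/λ_N²) ∫₀¹ ρ^{(β-1,α-β-1)}(x) f(x)² dx; moreover there is a constant C > 0 depending only on α and β such that (1/λ_N²) ≤ C (N+1)^{-2(α-1)}. -/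

import Mathlib

open Real MeasureTheory

/-- Jacobi polynomial `P_n^{(a,b)}(x)`. -/
noncomputable def jacobiP (a b : ℝ) (n : ℕ) (x : ℝ) : ℝ :=
  ∑ m ∈ Finset.range (n + 1),
    (1 / 2 ^ n : ℝ) *
      (Real.Gamma ((n : ℝ) + a + 1) /
        (Real.Gamma ((m : ℝ) + 1) * Real.Gamma ((n : ℝ) + a - (m : ℝ) + 1))) *
      (Real.Gamma ((n : ℝ) + b + 1) /
        (Real.Gamma ((n : ℝ) - (m : ℝ) + 1) * Real.Gamma (b + (m : ℝ) + 1))) *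
      (x - 1) ^ (n - m) * (x + 1) ^ m

/-- Shifted Jacobi polynomial `G_n^{(a,b)}(t) = P_n^{(a,b)}(2t-1)`. -/
noncomputable def jacobiG (a b : ℝ) (n : ℕ) (t : ℝ) : ℝ :=
  jacobiP a b n (2 * t - 1)

/-- Square of the norm constant `|‖G_n^{(a,b)}‖|`. -/
noncomputable def Gnorm2 (a b : ℝ) (n : ℕ) : ℝ :=
  Real.Gamma ((n : ℝ) + a + 1) * Real.Gamma ((n : ℝ) + b + 1) /
    ((2 * (n : ℝ) + a + b + 1) * Real.Gamma ((n : ℝ) + 1) * Real.Gamma ((n : ℝ) + a + b + 1))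

/-- The weight function `ρ^{(a,b)}(x) = (1-x)^a x^b`. -/
noncomputable def rho (a b x : ℝ) : ℝ := (1 - x) ^ a * x ^ b

/-- The eigenvalue `λ_n = [sin(πα)/(sin(π(α-β))+sin(πβ))]·Γ(n+α)/n!`. -/
noncomputable def lamda (α β : ℝ) (n : ℕ) : ℝ :=
  Real.sin (π * α) / (Real.sin (π * (α - β)) + Real.sin (π * β)) *
    (Real.Gamma ((n : ℝ) + α) / (n.factorial : ℝ))

open Polynomial in
/-- The Gamma function at an integer shift, as a rising factorial. -/
lemma Real.Gamma_add_natCast_eq {z : ℝ} (hz : 0 < z) (k : ℕ) :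
    Real.Gamma (z + k) = (ascPochhammer ℝ k).eval z * Real.Gamma z := by
  induction k with
  | zero => simp
  | succ k ih =>
    have h : z + k ≠ 0 := by positivity
    rw [Nat.cast_succ, ← add_assoc, Real.Gamma_add_one h, ih, ascPochhammer_succ_eval]
    ring

open Polynomial in
/-- Generalized binomial coefficients as quotients of Gamma values. -/
lemma Real.ringChoose_eq_Gamma {z : ℝ} {m : ℕ} (hz : 0 < z - m + 1) :
    Ring.choose z m = Real.Gamma (z + 1) / (Real.Gamma (m + 1) * Real.Gamma (z - m + 1)) := by
  have hfac : (m.factorial : ℝ) ≠ 0 := by positivity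
  have hdesc : (m.factorial : ℝ) * Ring.choose z m = (descPochhammer ℝ m).eval z := by
    rw [← nsmul_eq_mul, ← Ring.descPochhammer_eq_factorial_smul_choose, ← aeval_eq_smeval,
      ← descPochhammer_map (algebraMap ℤ ℝ), eval_map_algebraMap]
  have hG := Real.Gamma_add_natCast_eq hz m
  rw [← descPochhammer_eval_eq_ascPochhammer, ← hdesc, show z - m + 1 + m = z + 1 by ring] at hG
  have hpos := (Real.Gamma_pos_of_pos hz).ne'
  rw [hG, Real.Gamma_nat_eq_factorial]
  field_simp

lemma rho_intervalIntegrable {a b : ℝ} (ha : -1 < a) (hb : -1 < b) :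
    IntervalIntegrable (rho a b) volume 0 1 := by
  have h := (Complex.betaIntegral_convergent (u := ((b + 1 : ℝ) : ℂ)) (v := ((a + 1 : ℝ) : ℂ))
    (by rw [Complex.ofReal_re]; linarith) (by rw [Complex.ofReal_re]; linarith))
  rw [intervalIntegrable_iff_integrableOn_Ioc_of_le zero_le_one] at h ⊢
  refine (Integrable.re h).congr ?_
  filter_upwards [ae_restrict_mem measurableSet_Ioc] with x hx
  have h1 : (0 : ℝ) ≤ 1 - x := by linarith [hx.2]
  have : (x : ℂ) ^ (((b + 1 : ℝ) : ℂ) - 1) * (1 - (x : ℂ)) ^ (((a + 1 : ℝ) : ℂ) - 1)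
      = ((rho a b x : ℝ) : ℂ) := by
    rw [rho, Complex.ofReal_mul, Complex.ofReal_cpow h1, Complex.ofReal_cpow hx.1.le]
    push_cast
    simp only [add_sub_cancel_right]
    ring
  rw [this]
  rfl

lemma integral_rho {a b : ℝ} (ha : -1 < a) (hb : -1 < b) :
    ∫ x in (0 : ℝ)..1, rho a b x
      = Real.Gamma (a + 1) * Real.Gamma (b + 1) / Real.Gamma (a + b + 2) := by
  have ha' : 0 < a + 1 := by linarith
  have hb' : 0 < b + 1 := by linarith
  have h := Complex.betaIntegral_eq_Gamma_mul_div ((b + 1 : ℝ) : ℂ) ((a + 1 : ℝ) : ℂ)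
    (by rwa [Complex.ofReal_re]) (by rwa [Complex.ofReal_re])
  have hint : Complex.betaIntegral ((b + 1 : ℝ) : ℂ) ((a + 1 : ℝ) : ℂ)
      = ((∫ x in (0 : ℝ)..1, rho a b x : ℝ) : ℂ) := by
    rw [Complex.betaIntegral, ← intervalIntegral.integral_ofReal]
    refine intervalIntegral.integral_congr fun x hx => ?_
    rw [Set.uIcc_of_le zero_le_one] at hx
    have h1 : (0 : ℝ) ≤ 1 - x := by linarith [hx.2]
    simp only [rho]
    rw [Complex.ofReal_mul, Complex.ofReal_cpow h1, Complex.ofReal_cpow hx.1]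
    push_cast
    simp only [add_sub_cancel_right]
    ring
  rw [hint, ← Complex.ofReal_add, Complex.Gamma_ofReal, Complex.Gamma_ofReal,
    Complex.Gamma_ofReal] at h
  norm_cast at h
  rw [h, show b + 1 + (a + 1) = a + b + 2 by ring]
  ring

lemma rho_mul_pow {a b x : ℝ} (hx : x ∈ Set.Ioo (0 : ℝ) 1) (j k : ℕ) :
    rho a b x * ((1 - x) ^ j * x ^ k) = rho (a + j) (b + k) x := by
  have h1 : 0 < 1 - x := by linarith [hx.2]
  rw [rho, rho, Real.rpow_add_natCast h1.ne', Real.rpow_add_natCast hx.1.ne']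
  ring

/-- Functions agreeing on the open unit interval have the same integral over it. -/
lemma integral_unit_congr {f g : ℝ → ℝ} (h : ∀ x ∈ Set.Ioo (0 : ℝ) 1, f x = g x) :
    ∫ x in (0 : ℝ)..1, f x = ∫ x in (0 : ℝ)..1, g x := by
  rw [intervalIntegral.integral_of_le zero_le_one, intervalIntegral.integral_of_le zero_le_one,
    integral_Ioc_eq_integral_Ioo, integral_Ioc_eq_integral_Ioo]
  exact setIntegral_congr_fun measurableSet_Ioo h

lemma integral_rho_mul_pow {a b : ℝ} (ha : -1 < a) (hb : -1 < b) (j k : ℕ) :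
    ∫ x in (0 : ℝ)..1, rho a b x * ((x - 1) ^ j * x ^ k)
      = (-1) ^ j * (Real.Gamma (a + j + 1) * Real.Gamma (b + k + 1)
          / Real.Gamma (a + b + j + k + 2)) := by
  have hj : (0 : ℝ) ≤ j := j.cast_nonneg
  have hk : (0 : ℝ) ≤ k := k.cast_nonneg
  rw [integral_unit_congr (g := fun x => (-1) ^ j * rho (a + j) (b + k) x),
    intervalIntegral.integral_const_mul, integral_rho (by linarith) (by linarith),
    show a + j + (b + k) + 2 = a + b + j + k + 2 by ring]
  intro x hx
  rw [← rho_mul_pow hx, ← neg_sub 1 x, neg_pow]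
  ring

section ShiftedJacobi

open Polynomial

/-- The coefficient `C(n+a, m) C(n+b, n-m)` of the Jacobi polynomial, in Gamma form. -/
noncomputable def jacobiCoeff (a b : ℝ) (n m : ℕ) : ℝ :=
  Real.Gamma ((n : ℝ) + a + 1) /
      (Real.Gamma ((m : ℝ) + 1) * Real.Gamma ((n : ℝ) + a - (m : ℝ) + 1)) *
    (Real.Gamma ((n : ℝ) + b + 1) /
      (Real.Gamma ((n : ℝ) - (m : ℝ) + 1) * Real.Gamma (b + (m : ℝ) + 1)))

/-- The shifted Jacobi polynomial as an element of `ℝ[X]`. -/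
noncomputable def shiftedJacobi (a b : ℝ) (n : ℕ) : ℝ[X] :=
  ∑ m ∈ Finset.range (n + 1), C (jacobiCoeff a b n m) * ((X - 1) ^ (n - m) * X ^ m)

lemma eval_shiftedJacobi (a b : ℝ) (n : ℕ) (t : ℝ) :
    (shiftedJacobi a b n).eval t = jacobiG a b n t := by
  rw [shiftedJacobi, jacobiG, jacobiP, eval_finsetSum]
  refine Finset.sum_congr rfl fun m hm => ?_
  have hmn : m ≤ n := Nat.lt_succ_iff.mp (Finset.mem_range.mp hm)
  have h2 : (2 : ℝ) ^ n = 2 ^ (n - m) * 2 ^ m := by rw [← pow_add, Nat.sub_add_cancel hmn]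
  rw [show 2 * t - 1 - 1 = 2 * (t - 1) by ring, show 2 * t - 1 + 1 = 2 * t by ring,
    mul_pow, mul_pow, h2, jacobiCoeff]
  simp only [eval_mul, eval_C, eval_pow, eval_sub, eval_X, eval_one]
  field_simp

lemma monic_sub_one_pow_mul_X_pow (j k : ℕ) : ((X - 1 : ℝ[X]) ^ j * X ^ k).Monic := by
  rw [← C_1]
  exact ((monic_X_sub_C 1).pow j).mul (monic_X_pow k)

lemma natDegree_sub_one_pow_mul_X_pow (j k : ℕ) :
    ((X - 1 : ℝ[X]) ^ j * X ^ k).natDegree = j + k := by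
  rw [← C_1, ((monic_X_sub_C 1).pow j).natDegree_mul (monic_X_pow k), natDegree_pow,
    natDegree_X_sub_C, natDegree_X_pow, mul_one]

lemma natDegree_shiftedJacobi_le (a b : ℝ) (n : ℕ) : (shiftedJacobi a b n).natDegree ≤ n := by
  refine natDegree_sum_le_of_forall_le _ _ fun m hm => ?_
  have hmn : m ≤ n := Nat.lt_succ_iff.mp (Finset.mem_range.mp hm)
  refine (natDegree_C_mul_le _ _).trans ?_
  rw [natDegree_sub_one_pow_mul_X_pow]
  omega

/-- The leading coefficient of the shifted Jacobi polynomial, by the Chu–Vandermonde identity. -/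
lemma coeff_shiftedJacobi {a b : ℝ} (ha : -1 < a) (hb : -1 < b) {n : ℕ}
    (hab : 0 < (n : ℝ) + a + b + 1) :
    (shiftedJacobi a b n).coeff n
      = Real.Gamma (2 * n + a + b + 1) / (Real.Gamma (n + 1) * Real.Gamma (n + a + b + 1)) := by
  have hlead : (shiftedJacobi a b n).coeff n
      = ∑ m ∈ Finset.range (n + 1), jacobiCoeff a b n m := by
    rw [shiftedJacobi, finsetSum_coeff]
    refine Finset.sum_congr rfl fun m hm => ?_
    have hmn : m ≤ n := Nat.lt_succ_iff.mp (Finset.mem_range.mp hm)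
    have h := monic_sub_one_pow_mul_X_pow (n - m) m
    rw [Monic, leadingCoeff, natDegree_sub_one_pow_mul_X_pow, Nat.sub_add_cancel hmn] at h
    rw [coeff_C_mul, h, mul_one]
  have hV := Ring.add_choose_eq (r := (n : ℝ) + a) (s := (n : ℝ) + b) n (Commute.all _ _)
  rw [Finset.Nat.sum_antidiagonal_eq_sum_range_succ
      (fun i j => Ring.choose ((n : ℝ) + a) i * Ring.choose ((n : ℝ) + b) j),
    Real.ringChoose_eq_Gamma (by linarith)] at hV
  rw [hlead, show 2 * (n : ℝ) + a + b + 1 = n + a + (n + b) + 1 by ring,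
    show (n : ℝ) + a + b + 1 = n + a + (n + b) - n + 1 by ring, hV]
  refine Finset.sum_congr rfl fun m hm => ?_
  have hmn : m ≤ n := Nat.lt_succ_iff.mp (Finset.mem_range.mp hm)
  have hmn' : (m : ℝ) ≤ n := Nat.cast_le.mpr hmn
  have hm0 : (0 : ℝ) ≤ m := m.cast_nonneg
  rw [Real.ringChoose_eq_Gamma (by linarith),
    Real.ringChoose_eq_Gamma (by rw [Nat.cast_sub hmn]; linarith), jacobiCoeff,
    Nat.cast_sub hmn, show (n : ℝ) + b - (n - m) + 1 = b + m + 1 by ring]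

lemma rho_mul_eval_intervalIntegrable {a b : ℝ} (ha : -1 < a) (hb : -1 < b) (p : ℝ[X]) :
    IntervalIntegrable (fun x => rho a b x * p.eval x) volume 0 1 :=
  (rho_intervalIntegrable ha hb).mul_continuousOn p.continuous.continuousOn

/-- The `n`-th finite difference of a polynomial of degree at most `n`. -/
lemma sum_alternating_choose_mul_eval (p : ℝ[X]) {n : ℕ} (hp : p.natDegree ≤ n) (y : ℝ) :
    ∑ m ∈ Finset.range (n + 1), (-1) ^ (n - m) * (n.choose m : ℝ) * p.eval (y + m)
      = p.coeff n * n.factorial := by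
  have h := fwdDiff_iter_eq_sum_shift (1 : ℝ) p.eval n y
  simp only [nsmul_eq_mul, mul_one, zsmul_eq_mul, Int.cast_mul, Int.cast_pow, Int.cast_neg,
    Int.cast_one, Int.cast_natCast] at h
  rw [← h]
  rcases hp.lt_or_eq with hlt | rfl
  · rw [fwdDiff_iter_eq_zero_of_degree_lt hlt, coeff_eq_zero_of_natDegree_lt hlt]
    simp
  · rw [fwdDiff_iter_degree_eq_factorial, leadingCoeff]
    simp

lemma jacobiCoeff_mul_Gamma {a b : ℝ} (ha : -1 < a) (hb : -1 < b) {n m : ℕ} (hmn : m ≤ n)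
    (k : ℕ) :
    jacobiCoeff a b n m *
        (Real.Gamma (a + (n - m : ℕ) + 1) * Real.Gamma (b + (m + k : ℕ) + 1))
      = Real.Gamma (n + a + 1) * Real.Gamma (n + b + 1) / n.factorial *
          (n.choose m * (ascPochhammer ℝ k).eval (b + 1 + m)) := by
  have hmn' : (m : ℝ) ≤ n := Nat.cast_le.mpr hmn
  have hm0 : (0 : ℝ) ≤ m := m.cast_nonneg
  have hbm : 0 < b + 1 + m := by linarith
  have h1 := (Real.Gamma_pos_of_pos (show 0 < (n : ℝ) + a - m + 1 by linarith)).ne'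
  have h2 := (Real.Gamma_pos_of_pos (show 0 < b + m + 1 by linarith)).ne'
  rw [jacobiCoeff, Nat.cast_sub hmn, Nat.cast_add,
    show a + ((n : ℝ) - m) + 1 = n + a - m + 1 by ring,
    show b + ((m : ℝ) + k) + 1 = b + 1 + m + k by ring, Real.Gamma_add_natCast_eq hbm,
    show b + 1 + (m : ℝ) = b + m + 1 by ring, Nat.cast_choose ℝ hmn, ← Nat.cast_sub hmn,
    Real.Gamma_nat_eq_factorial, Real.Gamma_nat_eq_factorial]
  field_simp

/-- Moments of the shifted Jacobi polynomial of degree `n` against `X ^ k`, `k ≤ n`. -/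
lemma integral_shiftedJacobi_mul_pow {a b : ℝ} (ha : -1 < a) (hb : -1 < b) {n k : ℕ}
    (hk : k ≤ n) :
    ∫ x in (0 : ℝ)..1, rho a b x * (shiftedJacobi a b n * X ^ k).eval x
      = if k = n then Real.Gamma (n + a + 1) * Real.Gamma (n + b + 1)
          / Real.Gamma (2 * n + a + b + 2) else 0 := by
  have hexp : ∀ x, rho a b x * (shiftedJacobi a b n * X ^ k).eval x
      = ∑ m ∈ Finset.range (n + 1), jacobiCoeff a b n m *
          (rho a b x * ((x - 1) ^ (n - m) * x ^ (m + k))) := by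
    intro x
    rw [shiftedJacobi, Finset.sum_mul, eval_finsetSum, Finset.mul_sum]
    refine Finset.sum_congr rfl fun m _ => ?_
    simp only [eval_mul, eval_C, eval_pow, eval_sub, eval_X, eval_one]
    ring
  simp_rw [hexp]
  rw [intervalIntegral.integral_finsetSum]
  · simp_rw [intervalIntegral.integral_const_mul, integral_rho_mul_pow ha hb]
    have hterm : ∀ m ∈ Finset.range (n + 1),
        jacobiCoeff a b n m * ((-1) ^ (n - m) *
          (Real.Gamma (a + (n - m : ℕ) + 1) * Real.Gamma (b + (m + k : ℕ) + 1) /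
            Real.Gamma (a + b + (n - m : ℕ) + (m + k : ℕ) + 2)))
        = Real.Gamma (n + a + 1) * Real.Gamma (n + b + 1) / n.factorial /
            Real.Gamma (a + b + n + k + 2) *
          ((-1) ^ (n - m) * (n.choose m : ℝ) * (ascPochhammer ℝ k).eval (b + 1 + m)) := by
      intro m hm
      have hmn : m ≤ n := Nat.lt_succ_iff.mp (Finset.mem_range.mp hm)
      have hsum : a + b + ((n - m : ℕ) : ℝ) + ((m + k : ℕ) : ℝ) + 2 = a + b + n + k + 2 := by
        rw [Nat.cast_sub hmn]
        push_cast
        ring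
      rw [hsum]
      linear_combination ((-1) ^ (n - m) / Real.Gamma (a + b + n + k + 2)) *
        jacobiCoeff_mul_Gamma ha hb hmn k
    rw [Finset.sum_congr rfl hterm, ← Finset.mul_sum,
      sum_alternating_choose_mul_eval _ (by rwa [ascPochhammer_natDegree])]
    split_ifs with hkn
    · subst hkn
      have hlead := (monic_ascPochhammer ℝ k).leadingCoeff
      rw [leadingCoeff, ascPochhammer_natDegree] at hlead
      rw [hlead, show a + b + (k : ℝ) + k + 2 = 2 * k + a + b + 2 by ring]
      field_simp
    · rw [coeff_eq_zero_of_natDegree_lt (by rw [ascPochhammer_natDegree]; omega)]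
      simp
  · intro m _
    refine IntervalIntegrable.const_mul ?_ _
    have h := rho_mul_eval_intervalIntegrable ha hb ((X - 1) ^ (n - m) * X ^ (m + k))
    simpa only [eval_mul, eval_pow, eval_sub, eval_X, eval_one] using h

/-- Pairing the shifted Jacobi polynomial with a polynomial of degree at most `n` only sees the
coefficient of `X ^ n`. -/
lemma integral_shiftedJacobi_mul {a b : ℝ} (ha : -1 < a) (hb : -1 < b) {n : ℕ} {p : ℝ[X]}
    (hp : p.natDegree ≤ n) :
    ∫ x in (0 : ℝ)..1, rho a b x * ((shiftedJacobi a b n).eval x * p.eval x)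
      = p.coeff n * (Real.Gamma (n + a + 1) * Real.Gamma (n + b + 1)
          / Real.Gamma (2 * n + a + b + 2)) := by
  have hexp : ∀ x, rho a b x * ((shiftedJacobi a b n).eval x * p.eval x)
      = ∑ k ∈ Finset.range (n + 1), p.coeff k *
          (rho a b x * (shiftedJacobi a b n * X ^ k).eval x) := by
    intro x
    rw [p.eval_eq_sum_range' (Nat.lt_succ_of_le hp), Finset.mul_sum, Finset.mul_sum]
    refine Finset.sum_congr rfl fun k _ => ?_
    simp only [eval_mul, eval_pow, eval_X]
    ring
  simp_rw [hexp]
  rw [intervalIntegral.integral_finsetSum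
    fun k _ => (rho_mul_eval_intervalIntegrable ha hb _).const_mul _]
  simp_rw [intervalIntegral.integral_const_mul]
  rw [Finset.sum_congr rfl fun k hk => by
    rw [integral_shiftedJacobi_mul_pow ha hb (Nat.lt_succ_iff.mp (Finset.mem_range.mp hk))]]
  simp

/-- The shifted Jacobi polynomials of positive degree are orthogonal, with squared norm
`Gnorm2`. -/
lemma integral_shiftedJacobi_mul_shiftedJacobi {a b : ℝ} (ha : -1 < a) (hb : -1 < b) {m n : ℕ}
    (hm : 0 < m) (hn : 0 < n) :
    ∫ x in (0 : ℝ)..1, rho a b x * ((shiftedJacobi a b m).eval x * (shiftedJacobi a b n).eval x)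
      = if m = n then Gnorm2 a b n else 0 := by
  rcases lt_trichotomy m n with h | rfl | h
  · simp_rw [mul_comm (eval _ (shiftedJacobi a b m))]
    rw [integral_shiftedJacobi_mul ha hb ((natDegree_shiftedJacobi_le a b m).trans h.le),
      coeff_eq_zero_of_natDegree_lt ((natDegree_shiftedJacobi_le a b m).trans_lt h), if_neg h.ne,
      zero_mul]
  · have hm' : (1 : ℝ) ≤ m := Nat.one_le_cast.mpr hm
    have hpos : 0 < 2 * (m : ℝ) + a + b + 1 := by linarith
    rw [integral_shiftedJacobi_mul ha hb (natDegree_shiftedJacobi_le a b m),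
      coeff_shiftedJacobi ha hb (by linarith), if_pos rfl, Gnorm2,
      show 2 * (m : ℝ) + a + b + 2 = 2 * m + a + b + 1 + 1 by ring, Real.Gamma_add_one hpos.ne']
    have h1 := (Real.Gamma_pos_of_pos hpos).ne'
    field_simp
  · rw [integral_shiftedJacobi_mul ha hb ((natDegree_shiftedJacobi_le a b n).trans h.le),
      coeff_eq_zero_of_natDegree_lt ((natDegree_shiftedJacobi_le a b n).trans_lt h), if_neg h.ne',
      zero_mul]

end ShiftedJacobi

lemma Gnorm2_pos {a b : ℝ} (ha : -1 < a) (hb : -1 < b) {n : ℕ} (hn : 0 < n) :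
    0 < Gnorm2 a b n := by
  have hn' : (1 : ℝ) ≤ n := Nat.one_le_cast.mpr hn
  have h1 := Real.Gamma_pos_of_pos (show 0 < (n : ℝ) + a + 1 by linarith)
  have h2 := Real.Gamma_pos_of_pos (show 0 < (n : ℝ) + b + 1 by linarith)
  have h3 := Real.Gamma_pos_of_pos (show 0 < (n : ℝ) + 1 by linarith)
  have h4 := Real.Gamma_pos_of_pos (show 0 < (n : ℝ) + a + b + 1 by linarith)
  have h5 : 0 < 2 * (n : ℝ) + a + b + 1 := by linarith
  rw [Gnorm2]
  positivity

open Polynomial in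
/-- Bessel's inequality for the shifted Jacobi polynomials of positive degree. Measurability of `f`
is not needed: a coefficient whose integrand is not integrable vanishes. -/
lemma sum_sq_div_Gnorm2_le {a b : ℝ} (ha : -1 < a) (hb : -1 < b) {f : ℝ → ℝ}
    (hf : IntervalIntegrable (fun x => rho a b x * f x ^ 2) volume 0 1) (s : Finset ℕ) :
    ∑ i ∈ s, (∫ x in (0 : ℝ)..1, rho a b x * f x * jacobiG a b (i + 1) x) ^ 2
        / Gnorm2 a b (i + 1)
      ≤ ∫ x in (0 : ℝ)..1, rho a b x * f x ^ 2 := by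
  set Q : ℕ → ℝ[X] := fun i => shiftedJacobi a b (i + 1) with hQ
  set e : ℕ → ℝ := fun i => ∫ x in (0 : ℝ)..1, rho a b x * f x * (Q i).eval x with he
  set h : ℕ → ℝ := fun i => Gnorm2 a b (i + 1) with hh
  set d : ℕ → ℝ := fun i => e i / h i with hd
  have hpos : ∀ i, 0 < h i := fun i => Gnorm2_pos ha hb i.succ_pos
  simp_rw [← eval_shiftedJacobi]
  change ∑ i ∈ s, e i ^ 2 / h i ≤ _
  have hint : ∀ i, IntervalIntegrable (fun x => d i * (rho a b x * f x * (Q i).eval x))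
      volume 0 1 := by
    intro i
    by_cases hi : IntervalIntegrable (fun x => rho a b x * f x * (Q i).eval x) volume 0 1
    · exact hi.const_mul _
    · have : d i = 0 := by
        simp only [hd, he]
        rw [intervalIntegral.integral_undef hi, zero_div]
      simp [this]
  have hint2 : ∀ i j, IntervalIntegrable
      (fun x => d i * d j * (rho a b x * ((Q i).eval x * (Q j).eval x))) volume 0 1 := by
    intro i j
    simpa only [eval_mul] using
      (rho_mul_eval_intervalIntegrable ha hb (Q i * Q j)).const_mul (d i * d j)
  have hsq : ∀ x, rho a b x * (f x - ∑ i ∈ s, d i * (Q i).eval x) ^ 2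
      = rho a b x * f x ^ 2 - 2 * (∑ i ∈ s, d i * (rho a b x * f x * (Q i).eval x))
        + ∑ i ∈ s, ∑ j ∈ s, d i * d j * (rho a b x * ((Q i).eval x * (Q j).eval x)) := by
    intro x
    have h1 : ∑ i ∈ s, d i * (rho a b x * f x * (Q i).eval x)
        = rho a b x * f x * ∑ i ∈ s, d i * (Q i).eval x := by
      rw [Finset.mul_sum]
      exact Finset.sum_congr rfl fun i _ => by ring
    have h2 : ∑ i ∈ s, ∑ j ∈ s, d i * d j * (rho a b x * ((Q i).eval x * (Q j).eval x))
        = rho a b x * ((∑ i ∈ s, d i * (Q i).eval x) * ∑ j ∈ s, d j * (Q j).eval x) := by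
      rw [Finset.sum_mul_sum, Finset.mul_sum]
      refine Finset.sum_congr rfl fun i _ => ?_
      rw [Finset.mul_sum]
      exact Finset.sum_congr rfl fun j _ => by ring
    rw [h1, h2]
    ring
  have hnonneg : 0 ≤ ∫ x in (0 : ℝ)..1, rho a b x * (f x - ∑ i ∈ s, d i * (Q i).eval x) ^ 2 := by
    refine intervalIntegral.integral_nonneg zero_le_one fun x hx => ?_
    have h1 : 0 ≤ 1 - x := by linarith [hx.2]
    have h2 : 0 ≤ x := hx.1
    rw [rho]
    positivity
  simp_rw [hsq] at hnonneg
  have hsum1 : IntervalIntegrable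
      (fun x => ∑ i ∈ s, d i * (rho a b x * f x * (Q i).eval x)) volume 0 1 := by
    simpa only [Finset.sum_fn] using IntervalIntegrable.sum s fun i _ => hint i
  have hsum2 : ∀ i, IntervalIntegrable
      (fun x => ∑ j ∈ s, d i * d j * (rho a b x * ((Q i).eval x * (Q j).eval x))) volume 0 1 := by
    intro i
    simpa only [Finset.sum_fn] using IntervalIntegrable.sum s fun j _ => hint2 i j
  have hsum3 : IntervalIntegrable
      (fun x => ∑ i ∈ s, ∑ j ∈ s, d i * d j * (rho a b x * ((Q i).eval x * (Q j).eval x)))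
      volume 0 1 := by
    simpa only [Finset.sum_fn] using IntervalIntegrable.sum s fun i _ => hsum2 i
  rw [intervalIntegral.integral_add (hf.sub (hsum1.const_mul 2)) hsum3,
    intervalIntegral.integral_sub hf (hsum1.const_mul 2), intervalIntegral.integral_const_mul,
    intervalIntegral.integral_finsetSum fun i _ => hint i,
    intervalIntegral.integral_finsetSum fun i _ => hsum2 i] at hnonneg
  have hcross : ∑ i ∈ s, ∫ x in (0 : ℝ)..1, d i * (rho a b x * f x * (Q i).eval x)
      = ∑ i ∈ s, e i ^ 2 / h i := by
    refine Finset.sum_congr rfl fun i _ => ?_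
    rw [intervalIntegral.integral_const_mul]
    change e i / h i * e i = _
    ring
  have hdiag : ∑ i ∈ s, ∫ x in (0 : ℝ)..1,
        ∑ j ∈ s, d i * d j * (rho a b x * ((Q i).eval x * (Q j).eval x))
      = ∑ i ∈ s, e i ^ 2 / h i := by
    refine Finset.sum_congr rfl fun i hi => ?_
    rw [intervalIntegral.integral_finsetSum fun j _ => hint2 i j]
    simp_rw [intervalIntegral.integral_const_mul, hQ,
      integral_shiftedJacobi_mul_shiftedJacobi ha hb (Nat.succ_pos _) (Nat.succ_pos _)]
    simp only [Nat.succ_eq_add_one, add_left_inj, mul_ite, mul_zero, Finset.sum_ite_eq, if_pos hi]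
    change e i / h i * (e i / h i) * h i = _
    have := (hpos i).ne'
    field_simp
  rw [hcross, hdiag] at hnonneg
  linarith

lemma Gamma_div_factorial_monotone {α : ℝ} (hα : 1 < α) :
    Monotone fun n : ℕ => Real.Gamma (n + α) / n.factorial := by
  refine monotone_nat_of_le_succ fun n => ?_
  have hn : (0 : ℝ) ≤ n := n.cast_nonneg
  have hpos : 0 < (n : ℝ) + α := by linarith
  have hG := Real.Gamma_pos_of_pos hpos
  rw [Nat.cast_succ, show (n : ℝ) + 1 + α = n + α + 1 by ring, Real.Gamma_add_one hpos.ne',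
    Nat.factorial_succ, div_le_div_iff₀ (by positivity) (by positivity)]
  push_cast
  have : Real.Gamma (n + α) * n.factorial * (n + 1)
      ≤ Real.Gamma (n + α) * n.factorial * (n + α) := by
    gcongr
  linarith

/-- A Gautschi-type lower bound, from the log-convexity of the Gamma function. -/
lemma rpow_le_two_mul_Gamma_div_factorial {α : ℝ} (hα1 : 1 < α) (hα2 : α < 2) (n : ℕ) :
    ((n : ℝ) + 1) ^ (α - 1) ≤ 2 * (Real.Gamma (n + α) / n.factorial) := by
  have hn : (0 : ℝ) ≤ n := n.cast_nonneg
  have hpos : 0 < (n : ℝ) + α := by linarith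
  have hn1 : 0 < (n : ℝ) + 1 := by linarith
  have hG := Real.Gamma_pos_of_pos hpos
  have hconv := Real.Gamma_mul_add_mul_le_rpow_Gamma_mul_rpow_Gamma (s := (n : ℝ) + α)
    (t := (n : ℝ) + α + 1) (a := α - 1) (b := 2 - α) hpos (by linarith) (by linarith)
    (by linarith) (by ring)
  have hfac : Real.Gamma ((α - 1) * (n + α) + (2 - α) * (n + α + 1)) = (n + 1) * n.factorial := by
    rw [show (α - 1) * ((n : ℝ) + α) + (2 - α) * (n + α + 1) = ((n + 1 : ℕ) : ℝ) + 1 by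
      push_cast; ring, Real.Gamma_nat_eq_factorial, Nat.factorial_succ]
    push_cast
    ring
  rw [hfac, Real.Gamma_add_one hpos.ne', Real.mul_rpow hpos.le hG.le, mul_left_comm,
    ← Real.rpow_add hG, show α - 1 + (2 - α) = 1 by ring, Real.rpow_one] at hconv
  have hbase : ((n : ℝ) + α) ^ (2 - α) ≤ 2 * ((n : ℝ) + 1) ^ (2 - α) := by
    calc ((n : ℝ) + α) ^ (2 - α) ≤ (2 * ((n : ℝ) + 1)) ^ (2 - α) := by
          gcongr
          linarith
      _ = 2 ^ (2 - α) * ((n : ℝ) + 1) ^ (2 - α) := Real.mul_rpow (by norm_num) hn1.le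
      _ ≤ 2 ^ (1 : ℝ) * ((n : ℝ) + 1) ^ (2 - α) := by
          gcongr <;> linarith
      _ = 2 * ((n : ℝ) + 1) ^ (2 - α) := by rw [Real.rpow_one]
  have hsplit : ((n : ℝ) + 1) ^ (α - 1) * ((n : ℝ) + 1) ^ (2 - α) = n + 1 := by
    rw [← Real.rpow_add hn1, show α - 1 + (2 - α) = 1 by ring, Real.rpow_one]
  have hr : 0 < ((n : ℝ) + 1) ^ (2 - α) := Real.rpow_pos_of_pos hn1 _
  have hf : (0 : ℝ) < n.factorial := by positivity
  rw [← mul_div_assoc, le_div_iff₀ hf]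
  refine le_of_mul_le_mul_right ?_ hr
  calc ((n : ℝ) + 1) ^ (α - 1) * n.factorial * ((n : ℝ) + 1) ^ (2 - α)
      = (n + 1) * n.factorial := by rw [mul_right_comm, hsplit]
    _ ≤ ((n : ℝ) + α) ^ (2 - α) * Real.Gamma (n + α) := hconv
    _ ≤ 2 * ((n : ℝ) + 1) ^ (2 - α) * Real.Gamma (n + α) := by gcongr
    _ = 2 * Real.Gamma (n + α) * ((n : ℝ) + 1) ^ (2 - α) := by ring

lemma Gnorm2_le_Gnorm2_succ {α β : ℝ} (hα : 1 < α) (hβ1 : α - 1 ≤ β) (hβ2 : β ≤ 1) (i : ℕ) :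
    Gnorm2 (α - β) β i ≤ Gnorm2 (β - 1) (α - β - 1) (i + 1) := by
  have hi : (0 : ℝ) ≤ i := i.cast_nonneg
  have h1 := Real.Gamma_pos_of_pos (show 0 < (i : ℝ) + (α - β) + 1 by linarith)
  have h2 := Real.Gamma_pos_of_pos (show 0 < (i : ℝ) + β + 1 by linarith)
  have h3 := Real.Gamma_pos_of_pos (show 0 < (i : ℝ) + 1 by linarith)
  have h4 := Real.Gamma_pos_of_pos (show 0 < (i : ℝ) + α by linarith)
  rw [Gnorm2, Gnorm2, Nat.cast_succ,
    show (i : ℝ) + 1 + (β - 1) + 1 = i + β + 1 by ring,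
    show (i : ℝ) + 1 + (α - β - 1) + 1 = i + (α - β) + 1 by ring,
    show 2 * ((i : ℝ) + 1) + (β - 1) + (α - β - 1) + 1 = 2 * i + α + 1 by ring,
    show 2 * (i : ℝ) + (α - β) + β + 1 = 2 * i + α + 1 by ring,
    show (i : ℝ) + 1 + (β - 1) + (α - β - 1) + 1 = i + α by ring,
    show (i : ℝ) + (α - β) + β + 1 = i + α + 1 by ring,
    Real.Gamma_add_one (show (i : ℝ) + 1 ≠ 0 by positivity),
    Real.Gamma_add_one (show (i : ℝ) + α ≠ 0 by positivity),
    mul_comm (Real.Gamma ((i : ℝ) + β + 1))]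
  gcongr _ / ?_
  have : (2 * (i : ℝ) + α + 1) * Real.Gamma (i + 1) * Real.Gamma (i + α) * (i + 1)
      ≤ (2 * (i : ℝ) + α + 1) * Real.Gamma (i + 1) * Real.Gamma (i + α) * (i + α) := by
    gcongr
  linarith

lemma one_div_lamda_sq_antitone {α : ℝ} (hα : 1 < α) (β : ℝ) :
    Antitone fun n : ℕ => 1 / lamda α β n ^ 2 := by
  intro m n hmn
  have hpos : ∀ k : ℕ, 0 < Real.Gamma (k + α) / k.factorial := fun k =>
    div_pos (Real.Gamma_pos_of_pos (by positivity)) (by positivity)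
  have hle := Gamma_div_factorial_monotone hα hmn
  simp only [lamda, mul_pow, one_div, mul_inv]
  have := hpos m
  gcongr

/-- Tail estimate for the spectral coefficients: the tail series
`Σ_{i=N}^∞ c_i² |‖G_i^{(α-β,β)}‖|²` converges, is bounded by `(1/λ_N²)·∫ρ^{(β-1,α-β-1)}f²`,
and `1/λ_N² ≤ C (N+1)^{-2(α-1)}`. -/
theorem tail_series_bound (α β : ℝ) (hα1 : 1 < α) (hα2 : α < 2)
    (hβ1 : α - 1 ≤ β) (hβ2 : β ≤ 1)
    (f : ℝ → ℝ)
    (hf : IntegrableOn (fun x => rho (β - 1) (α - β - 1) x * f x ^ 2) (Set.Ioo 0 1))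
    (fc : ℕ → ℝ)
    (hfc : ∀ i, fc i = ∫ x in (0:ℝ)..1,
        rho (β - 1) (α - β - 1) x * f x * jacobiG (β - 1) (α - β - 1) i x)
    (c : ℕ → ℝ)
    (hc : ∀ i, c i = fc (i + 1) / (lamda α β i * Gnorm2 (β - 1) (α - β - 1) (i + 1))) :
    (∀ N : ℕ,
      Summable (fun i : ℕ => c (N + i) ^ 2 * Gnorm2 (α - β) β (N + i)) ∧
      (∑' i : ℕ, c (N + i) ^ 2 * Gnorm2 (α - β) β (N + i)) ≤
        (1 / (lamda α β N) ^ 2) *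
          ∫ x in (0:ℝ)..1, rho (β - 1) (α - β - 1) x * f x ^ 2) ∧
    ∃ C : ℝ, 0 < C ∧ ∀ N : ℕ,
      1 / (lamda α β N) ^ 2 ≤ C * ((N : ℝ) + 1) ^ (-2 * (α - 1)) := by
  have ha : -1 < β - 1 := by linarith
  have hb : -1 < α - β - 1 := by linarith
  have hf' : IntervalIntegrable (fun x => rho (β - 1) (α - β - 1) x * f x ^ 2) volume 0 1 := by
    rwa [intervalIntegrable_iff_integrableOn_Ioo_of_le zero_le_one]
  set h : ℕ → ℝ := fun i => Gnorm2 (β - 1) (α - β - 1) (i + 1) with hh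
  have hpos : ∀ i, 0 < h i := fun i => Gnorm2_pos ha hb i.succ_pos
  refine ⟨fun N => ?_, ?_⟩
  · set u : ℕ → ℝ := fun i => fc (N + i + 1) ^ 2 / h (N + i) with hu
    have hu0 : ∀ i, 0 ≤ u i := fun i => div_nonneg (sq_nonneg _) (hpos _).le
    have hu_sum : ∀ s : Finset ℕ,
        ∑ i ∈ s, u i ≤ ∫ x in (0:ℝ)..1, rho (β - 1) (α - β - 1) x * f x ^ 2 := by
      intro s
      have := sum_sq_div_Gnorm2_le ha hb hf' (s.map (addLeftEmbedding N))
      simpa only [Finset.sum_map, addLeftEmbedding_apply, ← hfc] using this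
    have hu_summable : Summable u := summable_of_sum_le hu0 hu_sum
    have hterm : ∀ i, c (N + i) ^ 2 * Gnorm2 (α - β) β (N + i) ≤ 1 / lamda α β N ^ 2 * u i := by
      intro i
      have hne := (hpos (N + i)).ne'
      calc c (N + i) ^ 2 * Gnorm2 (α - β) β (N + i)
          ≤ c (N + i) ^ 2 * h (N + i) := by
            gcongr
            exact Gnorm2_le_Gnorm2_succ hα1 hβ1 hβ2 _
        _ = 1 / lamda α β (N + i) ^ 2 * u i := by
            rw [hc]
            change (fc (N + i + 1) / (lamda α β (N + i) * h (N + i))) ^ 2 * h (N + i) = _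
            rw [div_pow, mul_pow, hu]
            field_simp
        _ ≤ 1 / lamda α β N ^ 2 * u i :=
            mul_le_mul_of_nonneg_right
              (one_div_lamda_sq_antitone hα1 β (Nat.le_add_right N i)) (hu0 i)
    have hterm0 : ∀ i, 0 ≤ c (N + i) ^ 2 * Gnorm2 (α - β) β (N + i) := by
      intro i
      have hN : (0 : ℝ) ≤ (N + i : ℕ) := Nat.cast_nonneg _
      refine mul_nonneg (sq_nonneg _) (div_nonneg (mul_nonneg ?_ ?_)
        (mul_nonneg (mul_nonneg ?_ ?_) ?_))
      any_goals exact (Real.Gamma_pos_of_pos (by linarith)).le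
      linarith
    have hsummable := Summable.of_nonneg_of_le hterm0 hterm (hu_summable.mul_left _)
    refine ⟨hsummable, ?_⟩
    refine (hsummable.tsum_le_tsum hterm (hu_summable.mul_left _)).trans ?_
    rw [tsum_mul_left]
    gcongr
    exact hu_summable.tsum_le_of_sum_le hu_sum
  · set K := Real.sin (π * α) / (Real.sin (π * (α - β)) + Real.sin (π * β)) with hK
    refine ⟨4 * (1 / K ^ 2) + 1, by positivity, fun N => ?_⟩
    have hN : (0 : ℝ) < (N : ℝ) + 1 := by positivity
    have hr : 0 < ((N : ℝ) + 1) ^ (α - 1) := Real.rpow_pos_of_pos hN _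
    have hbound := rpow_le_two_mul_Gamma_div_factorial hα1 hα2 N
    have hpow : ((N : ℝ) + 1) ^ (-2 * (α - 1)) = 1 / (((N : ℝ) + 1) ^ (α - 1)) ^ 2 := by
      rw [← Real.rpow_natCast, ← Real.rpow_mul hN.le, one_div, ← Real.rpow_neg hN.le]
      congr 1
      push_cast
      ring
    have hg : 1 / (Real.Gamma (N + α) / N.factorial) ^ 2
        ≤ 4 * (1 / (((N : ℝ) + 1) ^ (α - 1)) ^ 2) := by
      calc 1 / (Real.Gamma (N + α) / N.factorial) ^ 2
          = 4 * (1 / (2 * (Real.Gamma (N + α) / N.factorial)) ^ 2) := by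
            rw [mul_pow]
            ring
        _ ≤ 4 * (1 / (((N : ℝ) + 1) ^ (α - 1)) ^ 2) := by gcongr
    rw [hpow]
    calc 1 / lamda α β N ^ 2
        = 1 / K ^ 2 * (1 / (Real.Gamma (N + α) / N.factorial) ^ 2) := by
          rw [lamda, mul_pow, one_div_mul_one_div]
      _ ≤ 1 / K ^ 2 * (4 * (1 / (((N : ℝ) + 1) ^ (α - 1)) ^ 2)) := by gcongr
      _ ≤ (4 * (1 / K ^ 2) + 1) * (1 / (((N : ℝ) + 1) ^ (α - 1)) ^ 2) := by
          have : 0 ≤ 1 / (((N : ℝ) + 1) ^ (α - 1)) ^ 2 := by positivity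
          linarith
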